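/- (Main value-function bound, stated via a bisimulation embedding.) Let E be a real normed vector space and φ : S → E a map such that the true value function is 1-Lipschitz with respect to φ, i.e. |V^π_{(T,r)}(x) − V^π_{(T,r)}(y)| ≤ ‖φ(x) − φ(y)‖ for all states x, y. Assume that each stitch is ε-accurate under φ: for every b ∈ B, ‖φ(T(b, π(b))) − φ(c(b))‖ ≤ ε(b). Then for every state s, V^π_{(T', r^−)}(s) ≤ V^π_{(T,r)}(s) ≤ V^π_{(T', r^+)}(s). -/

import Mathlib

/-- The trajectory of policy `π` in the deterministic MDP with transition `T`,
starting from `s`: `traj T π s 0 = s`, `traj T π s (k+1) = T (traj T π s k) (π (traj T π s k))`. -/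
noncomputable def traj {S A : Type*} (T : S → A → S) (π : S → A) (s : S) : ℕ → S :=
  fun k => (fun x => T x (π x))^[k] s

/-- The value function of policy `π` with discount `γ`. -/
noncomputable def V {S A : Type*} (T : S → A → S) (r : S → A → ℝ) (π : S → A)
    (γ : ℝ) (s : S) : ℝ :=
  ∑' k : ℕ, γ ^ k * r (traj T π s k) (π (traj T π s k))

open scoped Classical in
/-- The stitched transition function: `T'(s,a) = c(s)` if `s ∈ B` and `a = π(s)`, else `T(s,a)`. -/
noncomputable def Tstitch {S A : Type*} (T : S → A → S) (π : S → A) (B : Set S) (c : S → S) :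
    S → A → S :=
  fun s a => if s ∈ B ∧ a = π s then c s else T s a

open scoped Classical in
/-- The pessimistic reward: `r⁻(s,a) = r(s,a) − γ·ε(s)` if `s ∈ B` and `a = π(s)`, else `r(s,a)`. -/
noncomputable def rPess {S A : Type*} (r : S → A → ℝ) (π : S → A) (B : Set S) (ε : S → ℝ)
    (γ : ℝ) : S → A → ℝ :=
  fun s a => if s ∈ B ∧ a = π s then r s a - γ * ε s else r s a

open scoped Classical in
/-- The optimistic reward: `r⁺(s,a) = r(s,a) + γ·ε(s)` if `s ∈ B` and `a = π(s)`, else `r(s,a)`. -/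
noncomputable def rOpt {S A : Type*} (r : S → A → ℝ) (π : S → A) (B : Set S) (ε : S → ℝ)
    (γ : ℝ) : S → A → ℝ :=
  fun s a => if s ∈ B ∧ a = π s then r s a + γ * ε s else r s a

theorem V_sub_le {S A : Type*} (T : S → A → S) (r : S → A → ℝ) (π : S → A) (γ M : ℝ)
    (hγ0 : 0 ≤ γ) (hγ1 : γ < 1) (W : S → ℝ) (hW : ∀ s, |W s| ≤ M)
    (hB : ∀ s, r s (π s) + γ * W (T s (π s)) ≤ W s) (s : S)
    (hs : Summable (fun k : ℕ => γ ^ k * r (traj T π s k) (π (traj T π s k)))) :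
    V T r π γ s ≤ W s := by
  have key : ∀ n : ℕ, (∑ k ∈ Finset.range n, γ ^ k * r (traj T π s k) (π (traj T π s k)))
      + γ ^ n * W (traj T π s n) ≤ W s := by
    intro n
    induction n with
    | zero => simp [traj]
    | succ n ih =>
      have e : traj T π s (n + 1) = T (traj T π s n) (π (traj T π s n)) := by
        simp only [traj, Function.iterate_succ_apply']
      have h := mul_le_mul_of_nonneg_left (hB (traj T π s n)) (pow_nonneg hγ0 n)
      rw [Finset.sum_range_succ, e, pow_succ]
      linarith
  have h0 : Filter.Tendsto (fun n : ℕ => γ ^ n * W (traj T π s n)) Filter.atTop (nhds 0) := by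
    have h1 : Filter.Tendsto (fun n : ℕ => γ ^ n * M) Filter.atTop (nhds 0) := by
      simpa using (tendsto_pow_atTop_nhds_zero_of_lt_one hγ0 hγ1).mul_const M
    refine squeeze_zero_norm (fun n => ?_) h1
    rw [Real.norm_eq_abs, abs_mul, abs_of_nonneg (pow_nonneg hγ0 n)]
    exact mul_le_mul_of_nonneg_left (hW _) (pow_nonneg hγ0 n)
  have h2 := hs.hasSum.tendsto_sum_nat.add h0
  rw [add_zero] at h2
  exact le_of_tendsto' h2 key

theorem V_summable {S A : Type*} (T : S → A → S) (r : S → A → ℝ) (π : S → A) (γ R : ℝ)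
    (hγ0 : 0 ≤ γ) (hγ1 : γ < 1) (hR : ∀ s a, |r s a| ≤ R) (s : S) :
    Summable (fun k : ℕ => γ ^ k * r (traj T π s k) (π (traj T π s k))) := by
  refine Summable.of_norm_bounded ((summable_geometric_of_lt_one hγ0 hγ1).mul_right R)
    (fun n => ?_)
  rw [Real.norm_eq_abs, abs_mul, abs_of_nonneg (pow_nonneg hγ0 n)]
  exact mul_le_mul_of_nonneg_left (hR _ _) (pow_nonneg hγ0 n)

theorem V_bound {S A : Type*} (T : S → A → S) (r : S → A → ℝ) (π : S → A) (γ R : ℝ)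
    (hγ0 : 0 ≤ γ) (hγ1 : γ < 1) (hR : ∀ s a, |r s a| ≤ R) (s : S) :
    |V T r π γ s| ≤ (1 - γ)⁻¹ * R := by
  have h := (hasSum_geometric_of_lt_one hγ0 hγ1).mul_right R
  have h2 := tsum_of_norm_bounded (f := fun k : ℕ =>
    γ ^ k * r (traj T π s k) (π (traj T π s k))) h (fun n => by
      rw [Real.norm_eq_abs, abs_mul, abs_of_nonneg (pow_nonneg hγ0 n)]
      exact mul_le_mul_of_nonneg_left (hR _ _) (pow_nonneg hγ0 n))
  simpa [V] using h2

theorem V_bellman {S A : Type*} (T : S → A → S) (r : S → A → ℝ) (π : S → A) (γ R : ℝ)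
    (hγ0 : 0 ≤ γ) (hγ1 : γ < 1) (hR : ∀ s a, |r s a| ≤ R) (s : S) :
    V T r π γ s = r s (π s) + γ * V T r π γ (T s (π s)) := by
  have h := (V_summable T r π γ R hγ0 hγ1 hR s).tsum_eq_zero_add
  unfold V
  rw [h, ← tsum_mul_left]
  congr 1
  · simp [traj]
  · refine tsum_congr (fun k => ?_)
    simp only [traj, Function.iterate_succ_apply, pow_succ]
    ring

/-- Main value-function bound, stated via a bisimulation embedding `φ : S → E` into a real normed
space for which the true value function is 1-Lipschitz. If every stitch is `ε`-accurate under
`φ`, then `V^π_{(T',r⁻)}(s) ≤ V^π_{(T,r)}(s) ≤ V^π_{(T',r⁺)}(s)` for every state `s` (where the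
stitched value functions are well defined, i.e. their defining series are summable). -/
theorem stitched_value_bounds {S A E : Type*} [NormedAddCommGroup E] [NormedSpace ℝ E]
    (T : S → A → S) (r : S → A → ℝ) (π : S → A) (γ R : ℝ)
    (hγ0 : 0 ≤ γ) (hγ1 : γ < 1) (hR : ∀ s a, |r s a| ≤ R)
    (B : Set S) (c : S → S) (ε : S → ℝ) (hε0 : ∀ b ∈ B, 0 ≤ ε b)
    (φ : S → E)
    (hLip : ∀ x y, |V T r π γ x - V T r π γ y| ≤ ‖φ x - φ y‖)
    (hstitch : ∀ b ∈ B, ‖φ (T b (π b)) - φ (c b)‖ ≤ ε b)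
    (hSumPess : ∀ s, Summable (fun k : ℕ =>
      γ ^ k * rPess r π B ε γ (traj (Tstitch T π B c) π s k)
        (π (traj (Tstitch T π B c) π s k))))
    (hSumOpt : ∀ s, Summable (fun k : ℕ =>
      γ ^ k * rOpt r π B ε γ (traj (Tstitch T π B c) π s k)
        (π (traj (Tstitch T π B c) π s k)))) :
    ∀ s, V (Tstitch T π B c) (rPess r π B ε γ) π γ s ≤ V T r π γ s ∧
      V T r π γ s ≤ V (Tstitch T π B c) (rOpt r π B ε γ) π γ s := by
  intro s
  have hb := V_bound T r π γ R hγ0 hγ1 hR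
  have hbel := V_bellman T r π γ R hγ0 hγ1 hR
  have hd : ∀ b ∈ B, |γ * V T r π γ (T b (π b)) - γ * V T r π γ (c b)| ≤ γ * ε b := by
    intro b hbB
    rw [← mul_sub, abs_mul, abs_of_nonneg hγ0]
    exact mul_le_mul_of_nonneg_left ((hLip _ _).trans (hstitch b hbB)) hγ0
  constructor
  · refine V_sub_le _ _ π γ _ hγ0 hγ1 _ hb (fun x => ?_) s (hSumPess s)
    by_cases hx : x ∈ B
    · have h1 := abs_le.1 (hd x hx)
      simp only [rPess, Tstitch, hx, and_self, if_true]
      linarith [hbel x, h1.1, h1.2]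
    · simp only [rPess, Tstitch, hx, false_and, if_false]
      exact (hbel x).ge
  · have h := V_sub_le (Tstitch T π B c) (fun x a => - rOpt r π B ε γ x a) π γ _ hγ0 hγ1
      (fun x => - V T r π γ x) (fun x => by rw [abs_neg]; exact hb x) (fun x => ?_) s
      (by simpa using (hSumOpt s).neg)
    · have e : V (Tstitch T π B c) (fun x a => - rOpt r π B ε γ x a) π γ s
          = - V (Tstitch T π B c) (rOpt r π B ε γ) π γ s := by
        simp only [V, mul_neg, tsum_neg]
      rw [e] at h
      linarith
    · by_cases hx : x ∈ B
      · have h1 := abs_le.1 (hd x hx)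
        simp only [rOpt, Tstitch, hx, and_self, if_true]
        linarith [hbel x, h1.1, h1.2]
      · simp only [rOpt, Tstitch, hx, false_and, if_false]
        linarith [hbel x]
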